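/- Let k > 0 and let ζ_i < ζ_{i+1} < ζ_{i+2} be real numbers; set Ω_i = {x ∈ ℝ² : ζ_i < x₂ < ζ_{i+1}}, Ω_{i+1} = {x ∈ ℝ² : ζ_{i+1} < x₂ < ζ_{i+2}} and H = {y ∈ ℝ² : y₂ < ζ_{i+2}}. Let a₁, a₂, J : ℝ² → ℂ be C¹ functions that are bounded, with bounded first derivatives, on H. Assume: (a) u : ℝ² → ℂ is C² and satisfies ∂₁(a₁∂₁u) + ∂₂(a₂∂₂u) + k²Ju = −J(f̄ + f) on ℝ², where f̄, f : ℝ² → ℂ are bounded, f̄ is supported in the closure of Ω_i and f is supported in the closure of Ω_{i+1}; (b) there is ζ′ > ζ_{i+2} such that g : ℝ² → ℂ is C² and satisfies ∂₁(a₁∂₁g) + ∂₂(a₂∂₂g) + k²Jg = 0 on {y : y₂ < ζ′}; (c) there exist C, c > 0 with |u(y)| + |∇u(y)| + |g(y)| + |∇g(y)| ≤ C·e^{−c|y|} for all y ∈ H; (d) β : ℝ → ℝ is C² with β(t) = 1 for t ≤ ζ_{i+1} and β(t) = 0 for t ≥ ζ_{i+2}. Define Ψ(y) = ∂₁(a₁∂₁(βu))(y)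 + ∂₂(a₂∂₂(βu))(y) + k²J(y)β(y₂)u(y), where (βu)(y) = β(y₂)u(y). Then ∫_{Ω_i} f̄(y)·J(y)·g(y) dy = ∫_{Ω_{i+1}} Ψ(y)·g(y) dy. -/

import Mathlib

open MeasureTheory

/-- Partial derivative in the first coordinate direction. -/
noncomputable def pd1 (f : ℝ × ℝ → ℂ) (p : ℝ × ℝ) : ℂ := fderiv ℝ f p (1, 0)

/-- Partial derivative in the second coordinate direction. -/
noncomputable def pd2 (f : ℝ × ℝ → ℂ) (p : ℝ × ℝ) : ℂ := fderiv ℝ f p (0, 1)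

open Set Filter Topology

/-- The exponential weight `exp (-c ‖y‖)` is integrable on the plane. -/
lemma integrable_exp_neg_mul_norm_plane {c : ℝ} (hc : 0 < c) :
    Integrable (fun y : ℝ × ℝ => Real.exp (-c * ‖y‖)) := by
  have h3 : Integrable (fun y : ℝ × ℝ => (1 + ‖y‖) ^ (-(3 : ℝ))) := by
    apply integrable_one_add_norm
    simp
    norm_num
  refine (h3.const_mul (Real.exp c * (6 / c ^ 3))).mono' (by fun_prop) (ae_of_all _ fun y => ?_)
  have hy : 0 < 1 + ‖y‖ := by positivity
  have h := Real.pow_div_factorial_le_exp (c * (1 + ‖y‖)) (by positivity) 3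
  rw [Real.norm_of_nonneg (Real.exp_pos _).le, Real.rpow_neg hy.le,
    show (3 : ℝ) = ((3 : ℕ) : ℝ) by norm_num, Real.rpow_natCast]
  have e1 : Real.exp (-c * ‖y‖) = Real.exp c * (Real.exp (c * (1 + ‖y‖)))⁻¹ := by
    rw [← Real.exp_neg, ← Real.exp_add]
    congr 1
    ring
  have e2 : Real.exp c * (6 / c ^ 3) * ((1 + ‖y‖) ^ 3)⁻¹
      = Real.exp c * ((c * (1 + ‖y‖)) ^ 3 / (Nat.factorial 3 : ℝ))⁻¹ := by
    simp only [Nat.factorial]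
    push_cast
    field_simp
  rw [e1, e2]
  gcongr

lemma norm_integral_edge_le {h : ℝ → ℂ} {M : ℝ} (n : ℕ) (hh : ∀ t, ‖h t‖ ≤ M) :
    ‖∫ t in (-(n : ℝ))..n, h t‖ ≤ 2 * n * M := by
  have := intervalIntegral.norm_integral_le_of_norm_le_const (a := -(n : ℝ)) (b := n)
    (f := h) (C := M) fun x _ => hh x
  rw [sub_neg_eq_add, abs_of_nonneg (by positivity)] at this
  linarith

/-- The integral over the plane of an integrable divergence of an exponentially decaying
vector field vanishes. -/
lemma integral_divergence_eq_zero_of_exp_decay {F₁ F₂ : ℝ × ℝ → ℂ} {K c : ℝ} (hc : 0 < c)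
    (hF₁ : ContDiff ℝ 1 F₁) (hF₂ : ContDiff ℝ 1 F₂)
    (hd₁ : ∀ y, ‖F₁ y‖ ≤ K * Real.exp (-c * ‖y‖))
    (hd₂ : ∀ y, ‖F₂ y‖ ≤ K * Real.exp (-c * ‖y‖))
    (hi : Integrable (fun y => pd1 F₁ y + pd2 F₂ y)) :
    ∫ y, (pd1 F₁ y + pd2 F₂ y) = 0 := by
  have hK : 0 ≤ K := by
    have := (norm_nonneg _).trans (hd₁ 0)
    simpa using this
  refine (aecover_closedBall (x := (0 : ℝ × ℝ))
    (tendsto_natCast_atTop_atTop (R := ℝ))).integral_eq_of_tendsto 0 hi ?_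
  have hlim : Tendsto (fun n : ℕ => 8 * K / c * ((c * n) ^ 1 * Real.exp (-(c * n)))) atTop
      (𝓝 0) := by
    have h1 : Tendsto (fun n : ℕ => c * (n : ℝ)) atTop atTop :=
      tendsto_natCast_atTop_atTop.const_mul_atTop hc
    simpa using ((Real.tendsto_pow_mul_exp_neg_atTop_nhds_zero 1).comp h1).const_mul (8 * K / c)
  refine squeeze_zero_norm (fun n => ?_) hlim
  have hball : Metric.closedBall (0 : ℝ × ℝ) (n : ℝ)
      = Icc (-(n : ℝ), -(n : ℝ)) ((n : ℝ), (n : ℝ)) := by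
    rw [show (0 : ℝ × ℝ) = (0, 0) from rfl, ← closedBall_prod_same, Real.closedBall_eq_Icc,
      Icc_prod_Icc]
    simp
  have hdiv := integral_divergence_prod_Icc_of_hasFDerivAt_of_le F₁ F₂ (fderiv ℝ F₁) (fderiv ℝ F₂)
    (-(n : ℝ), -(n : ℝ)) ((n : ℝ), (n : ℝ)) (by constructor <;> simp)
    hF₁.continuous.continuousOn hF₂.continuous.continuousOn
    (fun x _ => (hF₁.differentiable one_ne_zero x).hasFDerivAt)
    (fun x _ => (hF₂.differentiable one_ne_zero x).hasFDerivAt) hi.integrableOn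
  rw [hball]
  change ‖∫ x in Icc (-(n : ℝ), -(n : ℝ)) ((n : ℝ), (n : ℝ)),
    (fderiv ℝ F₁ x (1, 0) + fderiv ℝ F₂ x (0, 1))‖ ≤ _
  rw [hdiv]
  have hexp : ∀ y : ℝ × ℝ, (n : ℝ) ≤ ‖y‖ →
      K * Real.exp (-c * ‖y‖) ≤ K * Real.exp (-(c * n)) := by
    intro y hy
    gcongr
    nlinarith
  have hfst : ∀ s t : ℝ, |s| = n → (n : ℝ) ≤ ‖(s, t)‖ := fun s t hs => by
    rw [← hs]
    exact norm_fst_le (s, t)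
  have hsnd : ∀ s t : ℝ, |s| = n → (n : ℝ) ≤ ‖(t, s)‖ := fun s t hs => by
    rw [← hs]
    exact norm_snd_le (t, s)
  have b1 := norm_integral_edge_le n fun t =>
    (hd₂ (t, (n : ℝ))).trans (hexp _ (hsnd _ _ (by simp)))
  have b2 := norm_integral_edge_le n fun t =>
    (hd₂ (t, -(n : ℝ))).trans (hexp _ (hsnd _ _ (by simp)))
  have b3 := norm_integral_edge_le n fun t =>
    (hd₁ ((n : ℝ), t)).trans (hexp _ (hfst _ _ (by simp)))
  have b4 := norm_integral_edge_le n fun t =>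
    (hd₁ (-(n : ℝ), t)).trans (hexp _ (hfst _ _ (by simp)))
  have hval : 8 * K / c * ((c * n) ^ 1 * Real.exp (-(c * n)))
      = 4 * (2 * n * (K * Real.exp (-(c * n)))) := by
    field_simp
    ring
  rw [hval]
  refine (norm_sub_le _ _).trans ?_
  refine (add_le_add_left (norm_add_le _ _) _).trans ?_
  refine (add_le_add_left (add_le_add_left (norm_sub_le _ _) _) _).trans ?_
  dsimp only
  linarith

lemma fderiv_mul_dir {f h : ℝ × ℝ → ℂ} {y : ℝ × ℝ} (e : ℝ × ℝ)
    (hf : DifferentiableAt ℝ f y) (hh : DifferentiableAt ℝ h y) :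
    fderiv ℝ (fun z => f z * h z) y e = f y * fderiv ℝ h y e + fderiv ℝ f y e * h y := by
  rw [fderiv_fun_mul hf hh]
  simp [mul_comm]

lemma contDiff_fderiv_dir {f : ℝ × ℝ → ℂ} (hf : ContDiff ℝ 2 f) (e : ℝ × ℝ) :
    ContDiff ℝ 1 (fun z => fderiv ℝ f z e) :=
  (hf.fderiv_right (m := 1) (by norm_num)).clm_apply contDiff_const

/-- Pointwise Green identity in a fixed direction. -/
lemma fderiv_green_dir {a v g : ℝ × ℝ → ℂ} (ha : ContDiff ℝ 1 a) (hv : ContDiff ℝ 2 v)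
    (hg : ContDiff ℝ 2 g) (e y : ℝ × ℝ) :
    fderiv ℝ (fun z => a z * fderiv ℝ v z e * g z - v z * (a z * fderiv ℝ g z e)) y e
      = fderiv ℝ (fun z => a z * fderiv ℝ v z e) y e * g y
        - v y * fderiv ℝ (fun z => a z * fderiv ℝ g z e) y e := by
  have hP := (ha.mul (contDiff_fderiv_dir hv e)).differentiable one_ne_zero y
  have hQ := (ha.mul (contDiff_fderiv_dir hg e)).differentiable one_ne_zero y
  have hv' := hv.differentiable two_ne_zero y
  have hg' := hg.differentiable two_ne_zero y
  rw [fderiv_fun_sub (hP.fun_mul hg') (hv'.fun_mul hQ)]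
  simp only [_root_.sub_apply]
  rw [fderiv_mul_dir e hP hg', fderiv_mul_dir e hv' hQ]
  ring

lemma norm_fderiv_dir_le (f : ℝ × ℝ → ℂ) (y : ℝ × ℝ) {e : ℝ × ℝ} (he : ‖e‖ = 1) :
    ‖fderiv ℝ f y e‖ ≤ ‖fderiv ℝ f y‖ := by
  simpa [he] using (fderiv ℝ f y).le_opNorm e

/-- Derivative of a function of the second variable. -/
lemma fderiv_comp_snd {β : ℝ → ℝ} (hβ : Differentiable ℝ β) (y e : ℝ × ℝ) :
    fderiv ℝ (fun w : ℝ × ℝ => (β w.2 : ℂ)) y e = ((deriv β y.2 : ℝ) : ℂ) * e.2 := by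
  have h1 : HasFDerivAt (fun w : ℝ × ℝ => β w.2) _ y :=
    (hβ y.2).hasDerivAt.hasFDerivAt.comp y hasFDerivAt_snd
  have h2 : HasFDerivAt (fun w : ℝ × ℝ => (β w.2 : ℂ)) _ y :=
    Complex.ofRealCLM.hasFDerivAt.comp y h1
  rw [h2.fderiv]
  simp [mul_comm]

lemma contDiff_ofReal_comp_snd {β : ℝ → ℝ} {n : WithTop ℕ∞} (hβ : ContDiff ℝ n β) :
    ContDiff ℝ n (fun w : ℝ × ℝ => (β w.2 : ℂ)) :=
  Complex.ofRealCLM.contDiff.comp (hβ.comp contDiff_snd)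

/-- The principal part of the operator applied to a product with a cutoff in the second
variable. -/
lemma principal_part_cutoff_mul {a₁ a₂ u : ℝ × ℝ → ℂ} {β : ℝ → ℝ} (ha₁ : ContDiff ℝ 1 a₁)
    (ha₂ : ContDiff ℝ 1 a₂) (hu : ContDiff ℝ 2 u) (hβ : ContDiff ℝ 2 β) (y : ℝ × ℝ) :
    pd1 (fun z => a₁ z * pd1 (fun w => (β w.2 : ℂ) * u w) z) y
        + pd2 (fun z => a₂ z * pd2 (fun w => (β w.2 : ℂ) * u w) z) y
      = (β y.2 : ℂ) * (pd1 (fun z => a₁ z * pd1 u z) y + pd2 (fun z => a₂ z * pd2 u z) y)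
        + ((deriv β y.2 : ℝ) : ℂ) * (2 * (a₂ y * pd2 u y) + pd2 a₂ y * u y)
        + ((deriv (deriv β) y.2 : ℝ) : ℂ) * (a₂ y * u y) := by
  have hβd := hβ.differentiable two_ne_zero
  have hβ' : ContDiff ℝ 1 (deriv β) := hβ.deriv'
  have hb := (contDiff_ofReal_comp_snd hβ).differentiable two_ne_zero
  have hb' := (contDiff_ofReal_comp_snd hβ').differentiable one_ne_zero
  have hud := hu.differentiable two_ne_zero
  have e1 : (fun z => a₁ z * pd1 (fun w => (β w.2 : ℂ) * u w) z)
      = fun z => (β z.2 : ℂ) * (a₁ z * pd1 u z) := by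
    funext z
    simp only [pd1]
    rw [fderiv_mul_dir _ (hb z) (hud z), fderiv_comp_snd hβd]
    simp
    ring
  have e2 : (fun z => a₂ z * pd2 (fun w => (β w.2 : ℂ) * u w) z)
      = fun z => (β z.2 : ℂ) * (a₂ z * pd2 u z) + ((deriv β z.2 : ℝ) : ℂ) * (a₂ z * u z) := by
    funext z
    simp only [pd2]
    rw [fderiv_mul_dir _ (hb z) (hud z), fderiv_comp_snd hβd]
    simp
    ring
  have had := ha₂.differentiable one_ne_zero y
  have hP₁ := (ha₁.mul (contDiff_fderiv_dir hu (1, 0))).differentiable one_ne_zero y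
  have hP₂ := (ha₂.mul (contDiff_fderiv_dir hu (0, 1))).differentiable one_ne_zero y
  have hau : DifferentiableAt ℝ (fun z => a₂ z * u z) y := had.mul (hud y)
  rw [e1, e2]
  simp only [pd1, pd2]
  rw [fderiv_fun_add ((hb y).fun_mul hP₂) ((hb' y).fun_mul hau), _root_.add_apply,
    fderiv_mul_dir _ (hb y) hP₁, fderiv_mul_dir _ (hb y) hP₂, fderiv_mul_dir _ (hb' y) hau,
    fderiv_mul_dir _ had (hud y), fderiv_comp_snd hβd, fderiv_comp_snd hβd,
    fderiv_comp_snd (hβ'.differentiable one_ne_zero)]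
  simp
  ring

/-- A `C²` cutoff is bounded together with its first two derivatives. -/
lemma cutoff_bounded {β : ℝ → ℝ} {s t : ℝ} (hβ : ContDiff ℝ 2 β)
    (h1 : ∀ r, r ≤ s → β r = 1) (h0 : ∀ r, t ≤ r → β r = 0) :
    ∃ M : ℝ, 0 ≤ M ∧ ∀ r, |β r| ≤ M ∧ |deriv β r| ≤ M ∧ |deriv (deriv β) r| ≤ M := by
  have hβ' : ContDiff ℝ 1 (deriv β) := hβ.deriv'
  have hz : ∀ r, r ∉ Icc s t → deriv β r = 0 := by
    intro r hr
    rcases lt_or_ge r s with hrs | hrs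
    · have : β =ᶠ[𝓝 r] fun _ => 1 := by
        filter_upwards [Iio_mem_nhds hrs] with q hq using h1 q (le_of_lt hq)
      simp [this.deriv_eq]
    · have hrt : t < r := by
        by_contra hcon
        exact hr ⟨hrs, not_lt.1 hcon⟩
      have : β =ᶠ[𝓝 r] fun _ => 0 := by
        filter_upwards [Ioi_mem_nhds hrt] with q hq using h0 q (le_of_lt hq)
      simp [this.deriv_eq]
  have hcs : HasCompactSupport (deriv β) := HasCompactSupport.intro isCompact_Icc hz
  obtain ⟨M₁, hM₁⟩ := hβ'.continuous.bounded_above_of_compact_support hcs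
  obtain ⟨M₂, hM₂⟩ := (hβ'.continuous_deriv le_rfl).bounded_above_of_compact_support hcs.deriv
  obtain ⟨M₀, hM₀⟩ := isCompact_Icc (a := s) (b := t) |>.exists_bound_of_continuousOn
    hβ.continuous.continuousOn
  refine ⟨max (max (max M₀ 1) M₁) M₂, by positivity, fun r => ⟨?_, ?_, ?_⟩⟩
  · refine le_trans ?_ ((le_max_left _ M₁).trans (le_max_left _ _))
    rcases le_or_gt r s with hrs | hrs
    · simp [h1 r hrs]
    rcases le_or_gt t r with htr | htr
    · simp [h0 r htr]
    · exact (hM₀ r ⟨hrs.le, htr.le⟩).trans (le_max_left _ _)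
  · exact (hM₁ r).trans ((le_max_right _ _).trans (le_max_left _ _))
  · exact (hM₂ r).trans (le_max_right _ _)

/-- Horizontal lines are null sets of the plane. -/
lemma ae_snd_ne (s : ℝ) : ∀ᵐ y : ℝ × ℝ, y.2 ≠ s :=
  Measure.quasiMeasurePreserving_snd.ae (p := fun t : ℝ => t ≠ s) (Measure.ae_ne volume s)

lemma deriv_eq_zero_of_forall_Ici {h : ℝ → ℝ} (hd : Differentiable ℝ h) {t : ℝ}
    (h0 : ∀ r, t ≤ r → h r = 0) {r : ℝ} (hr : t ≤ r) : deriv h r = 0 := by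
  have hu : UniqueDiffWithinAt ℝ (Ici r) r := uniqueDiffOn_Ici r r self_mem_Ici
  rw [← (hd r).derivWithin hu,
    derivWithin_congr (s := Ici r) (f := fun _ => (0 : ℝ)) (fun q hq => h0 q (hr.trans hq)) (h0 r hr)]
  simp

/-- Pointwise decay of the flux appearing in the Green identity. -/
lemma norm_flux_le {α v w v' w' : ℂ} {B M C x : ℝ} (hB : 0 ≤ B) (hM : 0 ≤ M) (hC : 0 ≤ C)
    (hx0 : 0 ≤ x) (hx1 : x ≤ 1) (hα : ‖α‖ ≤ B) (hv : ‖v‖ ≤ M * (C * x))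
    (hv' : ‖v'‖ ≤ 2 * M * (C * x)) (hw : ‖w‖ ≤ C * x) (hw' : ‖w'‖ ≤ C * x) :
    ‖α * v' * w - v * (α * w')‖ ≤ 3 * B * M * C ^ 2 * x := by
  calc ‖α * v' * w - v * (α * w')‖ ≤ ‖α‖ * ‖v'‖ * ‖w‖ + ‖v‖ * (‖α‖ * ‖w'‖) := by
        refine (norm_sub_le _ _).trans_eq ?_
        simp only [norm_mul]
    _ ≤ B * (2 * M * (C * x)) * (C * x) + M * (C * x) * (B * (C * x)) := by gcongr
    _ = 3 * B * M * C ^ 2 * x * x := by ring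
    _ ≤ 3 * B * M * C ^ 2 * x := mul_le_of_le_one_right (by positivity) hx1

/-- Theorem 2.1(i) of the paper (classical form): the upward source transfer identity
`∫_{Ω_i} f̄ J g = ∫_{Ω_{i+1}} Ψ g`. -/
theorem stmt_1
    (k : ℝ) (hk : 0 < k)
    (ζi ζi1 ζi2 : ℝ) (hζ1 : ζi < ζi1) (hζ2 : ζi1 < ζi2)
    (a₁ a₂ J u g fbar f : ℝ × ℝ → ℂ) (β : ℝ → ℝ)
    (ha₁ : ContDiff ℝ 1 a₁) (ha₂ : ContDiff ℝ 1 a₂) (hJ : ContDiff ℝ 1 J)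
    (hbdd : ∃ B : ℝ, ∀ y : ℝ × ℝ, y.2 < ζi2 →
      ‖a₁ y‖ ≤ B ∧ ‖fderiv ℝ a₁ y‖ ≤ B ∧ ‖a₂ y‖ ≤ B ∧ ‖fderiv ℝ a₂ y‖ ≤ B ∧
      ‖J y‖ ≤ B ∧ ‖fderiv ℝ J y‖ ≤ B)
    (hu : ContDiff ℝ 2 u)
    (hfbar_bdd : ∃ B : ℝ, ∀ y, ‖fbar y‖ ≤ B)
    (hf_bdd : ∃ B : ℝ, ∀ y, ‖f y‖ ≤ B)
    (hfbar_supp : Function.support fbar ⊆ closure {x : ℝ × ℝ | ζi < x.2 ∧ x.2 < ζi1})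
    (hf_supp : Function.support f ⊆ closure {x : ℝ × ℝ | ζi1 < x.2 ∧ x.2 < ζi2})
    (hueq : ∀ y : ℝ × ℝ,
      pd1 (fun z => a₁ z * pd1 u z) y + pd2 (fun z => a₂ z * pd2 u z) y
        + (k : ℂ) ^ 2 * J y * u y = -(J y * (fbar y + f y)))
    (ζ' : ℝ) (hζ' : ζi2 < ζ')
    (hg : ContDiff ℝ 2 g)
    (hgeq : ∀ y : ℝ × ℝ, y.2 < ζ' →
      pd1 (fun z => a₁ z * pd1 g z) y + pd2 (fun z => a₂ z * pd2 g z) y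
        + (k : ℂ) ^ 2 * J y * g y = 0)
    (hdecay : ∃ C c : ℝ, 0 < C ∧ 0 < c ∧ ∀ y : ℝ × ℝ, y.2 < ζi2 →
      ‖u y‖ + ‖fderiv ℝ u y‖ + ‖g y‖ + ‖fderiv ℝ g y‖ ≤ C * Real.exp (-c * ‖y‖))
    (hβ : ContDiff ℝ 2 β)
    (hβ1 : ∀ t : ℝ, t ≤ ζi1 → β t = 1) (hβ0 : ∀ t : ℝ, ζi2 ≤ t → β t = 0) :
    ∫ y in {x : ℝ × ℝ | ζi < x.2 ∧ x.2 < ζi1}, fbar y * J y * g y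
      = ∫ y in {x : ℝ × ℝ | ζi1 < x.2 ∧ x.2 < ζi2},
          (pd1 (fun z => a₁ z * pd1 (fun w => (β w.2 : ℂ) * u w) z) y
            + pd2 (fun z => a₂ z * pd2 (fun w => (β w.2 : ℂ) * u w) z) y
            + (k : ℂ) ^ 2 * J y * (β y.2 : ℂ) * u y) * g y := by
  obtain ⟨B, hB⟩ := hbdd
  obtain ⟨Nb, hNb⟩ := hfbar_bdd
  obtain ⟨Nf, hNf⟩ := hf_bdd
  obtain ⟨C, c, hC, hc, hdec⟩ := hdecay
  obtain ⟨M, hM, hβM⟩ := cutoff_bounded hβ hβ1 hβ0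
  have hB0 : 0 ≤ B :=
    (norm_nonneg _).trans (hB (0, ζi1) hζ2).1
  have hβd := hβ.differentiable two_ne_zero
  have hβ' : ContDiff ℝ 1 (deriv β) := hβ.deriv'
  have hd1 : ∀ r, ζi2 ≤ r → deriv β r = 0 := fun r hr => deriv_eq_zero_of_forall_Ici hβd hβ0 hr
  have hd2 : ∀ r, ζi2 ≤ r → deriv (deriv β) r = 0 := fun r hr =>
    deriv_eq_zero_of_forall_Ici (hβ'.differentiable one_ne_zero) hd1 hr
  have hl1 : ∀ r, r < ζi1 → deriv β r = 0 := fun r hr => by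
    have : β =ᶠ[𝓝 r] fun _ => 1 := by
      filter_upwards [Iio_mem_nhds hr] with q hq using hβ1 q (le_of_lt hq)
    simp [this.deriv_eq]
  have hl2 : ∀ r, r < ζi1 → deriv (deriv β) r = 0 := fun r hr => by
    have : deriv β =ᶠ[𝓝 r] fun _ => 0 := by
      filter_upwards [Iio_mem_nhds hr] with q hq using hl1 q hq
    simp [this.deriv_eq]
  set v : ℝ × ℝ → ℂ := fun w => (β w.2 : ℂ) * u w with hvdef
  have hb := contDiff_ofReal_comp_snd hβ
  have hv : ContDiff ℝ 2 v := hb.mul hu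
  have hvd : ∀ y e : ℝ × ℝ, fderiv ℝ v y e
      = (β y.2 : ℂ) * fderiv ℝ u y e + ((deriv β y.2 : ℝ) : ℂ) * e.2 * u y := fun y e => by
    rw [hvdef, fderiv_mul_dir e (hb.differentiable two_ne_zero y) (hu.differentiable two_ne_zero y),
      fderiv_comp_snd hβd]
  have hv0 : ∀ y : ℝ × ℝ, ζi2 ≤ y.2 → v y = 0 := fun y hy => by simp [hvdef, hβ0 _ hy]
  have hvd0 : ∀ y e : ℝ × ℝ, ζi2 ≤ y.2 → fderiv ℝ v y e = 0 := fun y e hy => by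
    simp [hvd, hβ0 _ hy, hd1 _ hy]
  set D : ℝ × ℝ → ℂ := fun y =>
    (pd1 (fun z => a₁ z * pd1 v z) y + pd2 (fun z => a₂ z * pd2 v z) y
      + (k : ℂ) ^ 2 * J y * (β y.2 : ℂ) * u y) * g y with hDdef
  have hDexp : ∀ y, D y = (-((β y.2 : ℂ) * (J y * (fbar y + f y)))
      + ((deriv β y.2 : ℝ) : ℂ) * (2 * (a₂ y * pd2 u y) + pd2 a₂ y * u y)
      + ((deriv (deriv β) y.2 : ℝ) : ℂ) * (a₂ y * u y)) * g y := fun y => by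
    simp only [hDdef]
    rw [hvdef, principal_part_cutoff_mul ha₁ ha₂ hu hβ]
    linear_combination (β y.2 : ℂ) * g y * hueq y
  have hD0 : ∀ y : ℝ × ℝ, ζi2 ≤ y.2 → D y = 0 := fun y hy => by
    rw [hDexp, hβ0 _ hy, hd1 _ hy, hd2 _ hy]
    simp
  set F : (ℝ × ℝ → ℂ) → ℝ × ℝ → ℝ × ℝ → ℂ := fun a e z =>
    a z * fderiv ℝ v z e * g z - v z * (a z * fderiv ℝ g z e) with hFdef
  have hFsmooth : ∀ (a : ℝ × ℝ → ℂ) (e : ℝ × ℝ), ContDiff ℝ 1 a → ContDiff ℝ 1 (F a e) :=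
    fun a e ha => ((ha.mul (contDiff_fderiv_dir hv e)).mul (hg.of_le (by norm_num))).sub
      ((hv.of_le (by norm_num)).mul (ha.mul (contDiff_fderiv_dir hg e)))
  have hDF : ∀ y, D y = pd1 (F a₁ (1, 0)) y + pd2 (F a₂ (0, 1)) y := by
    intro y
    have g1 := fderiv_green_dir ha₁ hv hg (1, 0) y
    have g2 := fderiv_green_dir ha₂ hv hg (0, 1) y
    have hvg : v y * (pd1 (fun z => a₁ z * pd1 g z) y + pd2 (fun z => a₂ z * pd2 g z) y
        + (k : ℂ) ^ 2 * J y * g y) = 0 := by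
      rcases lt_or_ge y.2 ζ' with h | h
      · rw [hgeq y h, mul_zero]
      · rw [hv0 y (hζ'.le.trans h), zero_mul]
    have hvy : v y = (β y.2 : ℂ) * u y := rfl
    simp only [hDdef, hFdef]
    simp only [pd1, pd2] at hvg ⊢
    rw [g1, g2]
    linear_combination hvg - (k : ℂ) ^ 2 * J y * g y * hvy
  have hsmall : ∀ y : ℝ × ℝ, y.2 < ζi2 →
      ‖u y‖ ≤ C * Real.exp (-c * ‖y‖) ∧ ‖fderiv ℝ u y‖ ≤ C * Real.exp (-c * ‖y‖) ∧
      ‖g y‖ ≤ C * Real.exp (-c * ‖y‖) ∧ ‖fderiv ℝ g y‖ ≤ C * Real.exp (-c * ‖y‖) := fun y hy => by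
    have h := hdec y hy
    have h1 := norm_nonneg (u y)
    have h2 := norm_nonneg (fderiv ℝ u y)
    have h3 := norm_nonneg (g y)
    have h4 := norm_nonneg (fderiv ℝ g y)
    refine ⟨?_, ?_, ?_, ?_⟩ <;> linarith
  have hx1 : ∀ y : ℝ × ℝ, Real.exp (-c * ‖y‖) ≤ 1 := fun y => by
    rw [Real.exp_le_one_iff, neg_mul, neg_nonpos]
    positivity
  have hFdecay : ∀ (a : ℝ × ℝ → ℂ) (e : ℝ × ℝ), ‖e‖ = 1 → (∀ y : ℝ × ℝ, y.2 < ζi2 → ‖a y‖ ≤ B) →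
      ∀ y, ‖F a e y‖ ≤ 3 * B * M * C ^ 2 * Real.exp (-c * ‖y‖) := by
    intro a e he ha y
    rcases lt_or_ge y.2 ζi2 with hy | hy
    · obtain ⟨h1, h2, h3, h4⟩ := hsmall y hy
      refine norm_flux_le hB0 hM hC.le (Real.exp_pos _).le (hx1 y) (ha y hy) ?_ ?_ h3
        ((norm_fderiv_dir_le g y he).trans h4)
      · rw [hvdef, norm_mul, Complex.norm_real]
        exact mul_le_mul (hβM y.2).1 h1 (norm_nonneg _) hM
      · rw [hvd]
        have he2 : ‖(e.2 : ℂ)‖ ≤ 1 := by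
          rw [Complex.norm_real, ← he]
          exact norm_snd_le e
        have hu' := (norm_fderiv_dir_le u y he).trans h2
        have hβ0' : ‖(β y.2 : ℂ)‖ ≤ M := by
          rw [Complex.norm_real]; exact (hβM y.2).1
        have hβ1' : ‖((deriv β y.2 : ℝ) : ℂ)‖ ≤ M := by
          rw [Complex.norm_real]; exact (hβM y.2).2.1
        calc _ ≤ ‖(β y.2 : ℂ)‖ * ‖fderiv ℝ u y e‖
              + ‖((deriv β y.2 : ℝ) : ℂ)‖ * ‖(e.2 : ℂ)‖ * ‖u y‖ := by
                refine (norm_add_le _ _).trans_eq ?_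
                simp only [norm_mul]
          _ ≤ M * (C * Real.exp (-c * ‖y‖)) + M * 1 * (C * Real.exp (-c * ‖y‖)) := by gcongr
          _ = _ := by ring
    · simp only [hFdef, hv0 y hy, hvd0 y e hy, mul_zero, zero_mul, sub_zero, norm_zero]
      positivity
  have hDdecay : ∀ y, ‖D y‖ ≤
      (M * (B * (Nb + Nf)) + M * (2 * (B * C) + B * C) + M * (B * C)) * C
        * Real.exp (-c * ‖y‖) := by
    intro y
    have hNb0 : 0 ≤ Nb := (norm_nonneg _).trans (hNb 0)
    have hNf0 : 0 ≤ Nf := (norm_nonneg _).trans (hNf 0)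
    rcases lt_or_ge y.2 ζi2 with hy | hy
    · obtain ⟨h1, h2, h3, -⟩ := hsmall y hy
      obtain ⟨-, -, hA, hA', hJB, -⟩ := hB y hy
      have hCx : C * Real.exp (-c * ‖y‖) ≤ C := mul_le_of_le_one_right hC.le (hx1 y)
      have hu0 := h1.trans hCx
      have hu2 : ‖pd2 u y‖ ≤ C := (norm_fderiv_dir_le u y (by simp)).trans (h2.trans hCx)
      have ha2 : ‖pd2 a₂ y‖ ≤ B := (norm_fderiv_dir_le a₂ y (by simp)).trans hA'
      obtain ⟨hm0, hm1, hm2⟩ := hβM y.2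
      rw [← Real.norm_eq_abs, ← Complex.norm_real] at hm0 hm1 hm2
      have hff : ‖fbar y + f y‖ ≤ Nb + Nf := (norm_add_le _ _).trans (add_le_add (hNb y) (hNf y))
      rw [hDexp, norm_mul, mul_assoc _ C]
      refine mul_le_mul ?_ h3 (norm_nonneg _) (by positivity)
      refine (norm_add₃_le).trans ?_
      gcongr
      · rw [norm_neg, norm_mul, norm_mul]
        gcongr
      · rw [norm_mul]
        gcongr
        refine (norm_add_le _ _).trans ?_
        simp only [norm_mul, Complex.norm_ofNat]
        gcongr
      · rw [norm_mul, norm_mul]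
        gcongr
    · rw [hD0 y hy, norm_zero]
      positivity
  have hDcont : Continuous D := by
    rw [funext hDF]
    exact (((hFsmooth a₁ (1, 0) ha₁).continuous_fderiv one_ne_zero).clm_apply continuous_const).add
      (((hFsmooth a₂ (0, 1) ha₂).continuous_fderiv one_ne_zero).clm_apply continuous_const)
  have hDint : Integrable D :=
    ((integrable_exp_neg_mul_norm_plane hc).const_mul _).mono' hDcont.aestronglyMeasurable
      (ae_of_all _ hDdecay)
  have hDzero : ∫ y, D y = 0 := by
    rw [funext hDF] at hDint ⊢
    exact integral_divergence_eq_zero_of_exp_decay hc (hFsmooth a₁ _ ha₁) (hFsmooth a₂ _ ha₂)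
      (hFdecay a₁ _ (by simp) fun y hy => (hB y hy).1)
      (hFdecay a₂ _ (by simp) fun y hy => (hB y hy).2.2.1) hDint
  have hfbar0 : ∀ y : ℝ × ℝ, y.2 < ζi → fbar y = 0 := fun y hy => by
    by_contra hne
    have hcl : IsClosed {x : ℝ × ℝ | ζi ≤ x.2} := isClosed_le continuous_const continuous_snd
    have : ζi ≤ y.2 := closure_minimal (fun x hx => hx.1.le) hcl (hfbar_supp hne)
    exact absurd hy (not_lt.2 this)
  have hf0 : ∀ y : ℝ × ℝ, y.2 < ζi1 → f y = 0 := fun y hy => by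
    by_contra hne
    have hcl : IsClosed {x : ℝ × ℝ | ζi1 ≤ x.2} := isClosed_le continuous_const continuous_snd
    have : ζi1 ≤ y.2 := closure_minimal (fun x hx => hx.1.le) hcl (hf_supp hne)
    exact absurd hy (not_lt.2 this)
  have hDlow : ∀ y : ℝ × ℝ, y.2 < ζi1 → D y = -(fbar y * J y * g y) := fun y hy => by
    rw [hDexp, hβ1 _ hy.le, hl1 _ hy, hl2 _ hy, hf0 y hy]
    push_cast
    ring
  set S : Set (ℝ × ℝ) := {x : ℝ × ℝ | ζi < x.2 ∧ x.2 < ζi1} with hS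
  set T : Set (ℝ × ℝ) := {x : ℝ × ℝ | ζi1 < x.2 ∧ x.2 < ζi2} with hT
  have hSm : MeasurableSet S := measurable_snd measurableSet_Ioo
  have hTm : MeasurableSet T := measurable_snd measurableSet_Ioo
  have hdisj : Disjoint S T := Set.disjoint_left.2 fun y hy hy' => lt_asymm hy.2 hy'.1
  have hunion : ∫ y in S ∪ T, D y = ∫ y, D y := by
    refine setIntegral_eq_integral_of_ae_compl_eq_zero ?_
    filter_upwards [ae_snd_ne ζi, ae_snd_ne ζi1] with y hy hy1 hmem
    rcases lt_or_gt_of_ne hy with h | h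
    · rw [hDlow y (h.trans hζ1), hfbar0 y h]
      simp
    rcases lt_or_gt_of_ne hy1 with h1 | h1
    · exact absurd (Or.inl ⟨h, h1⟩) hmem
    · exact hD0 y (not_lt.1 fun h2 => hmem (Or.inr ⟨h1, h2⟩))
  rw [setIntegral_union hdisj hTm hDint.integrableOn hDint.integrableOn, hDzero,
    setIntegral_congr_fun hSm fun y hy => hDlow y hy.2, integral_neg] at hunion
  linear_combination -hunion
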